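/- The matrix V = I - gg*/(1/S + ||g||²) - E*(EE*)⁻¹E is Hermitian positive semidefinite, where g = (I - E*(EE*)⁻¹E)h for some h ∈ ℂ^L, S > 0, and E has full row rank. -/

import Mathlib

open Matrix

noncomputable def nsq {L : ℕ} (v : Fin L → ℂ) : ℝ := ∑ i, ‖v i‖ ^ 2

theorem nsq_nonneg {L : ℕ} (v : Fin L → ℂ) : 0 ≤ nsq v :=
  Finset.sum_nonneg fun _ _ => by positivity

theorem star_dotProduct_self_eq_nsq {L : ℕ} (v : Fin L → ℂ) : star v ⬝ᵥ v = (nsq v : ℂ) := by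
  simp [nsq, dotProduct, Complex.conj_mul']

/-- The Cauchy–Schwarz inequality. -/
theorem norm_star_dotProduct_sq_le {L : ℕ} (v w : Fin L → ℂ) :
    ‖star v ⬝ᵥ w‖ ^ 2 ≤ nsq v * nsq w := by
  have h : ‖star v ⬝ᵥ w‖ ≤ ∑ i, ‖v i‖ * ‖w i‖ :=
    (norm_sum_le _ _).trans_eq (by simp)
  calc ‖star v ⬝ᵥ w‖ ^ 2 ≤ (∑ i, ‖v i‖ * ‖w i‖) ^ 2 := by gcongr
    _ ≤ nsq v * nsq w := Finset.sum_mul_sq_le_sq_mul_sq _ _ _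

open scoped ComplexOrder in
theorem posSemidef_one_sub_smul_vecMulVec {L : ℕ} (g : Fin L → ℂ) {c : ℝ} (hc : 0 ≤ c)
    (hcg : c * nsq g ≤ 1) : (1 - (c : ℂ) • vecMulVec g (star g)).PosSemidef := by
  refine PosSemidef.of_dotProduct_mulVec_nonneg ?_ fun x => ?_
  · simp [IsHermitian, conjTranspose_vecMulVec]
  · have key : star x ⬝ᵥ ((1 - (c : ℂ) • vecMulVec g (star g)) *ᵥ x) =
        ((nsq x - c * ‖star g ⬝ᵥ x‖ ^ 2 : ℝ) : ℂ) := by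
      have hconj : star x ⬝ᵥ g = star (star g ⬝ᵥ x) := by
        rw [star_dotProduct]
      rw [sub_mulVec, one_mulVec, smul_mulVec, vecMulVec_mulVec, dotProduct_sub,
        star_dotProduct_self_eq_nsq, dotProduct_smul, dotProduct_smul, hconj]
      push_cast
      rw [← Complex.conj_mul']
      simp
    rw [key, Complex.zero_le_real, sub_nonneg]
    calc c * ‖star g ⬝ᵥ x‖ ^ 2 ≤ c * (nsq g * nsq x) := by
          gcongr; exact norm_star_dotProduct_sq_le g x
      _ = c * nsq g * nsq x := by ring
      _ ≤ 1 * nsq x := by gcongr; exact nsq_nonneg x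
      _ = nsq x := one_mul _

open scoped ComplexOrder in
theorem posSemidef_sub_smul_vecMulVec {L : ℕ} {Q : Matrix (Fin L) (Fin L) ℂ} {g : Fin L → ℂ}
    (hQH : Qᴴ = Q) (hQQ : Q * Q = Q) (hQg : Q *ᵥ g = g) {c : ℝ} (hc : 0 ≤ c)
    (hcg : c * nsq g ≤ 1) : (Q - (c : ℂ) • vecMulVec g (star g)).PosSemidef := by
  have hgQ : star g ᵥ* Q = star g := by
    nth_rw 1 [← hQH]
    rw [← star_mulVec, hQg]
  have hconj := (posSemidef_one_sub_smul_vecMulVec g hc hcg).conjTranspose_mul_mul_same Q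
  rwa [hQH, Matrix.mul_sub, Matrix.mul_one, Matrix.sub_mul, hQQ, Matrix.mul_smul,
    Matrix.smul_mul, mul_vecMulVec, vecMulVec_mul, hQg, hgQ] at hconj

open scoped ComplexOrder in
theorem Matrix.PosSemidef.conjTranspose_eq_and_re_nonneg {L : ℕ}
    {A : Matrix (Fin L) (Fin L) ℂ} (hA : A.PosSemidef) :
    Aᴴ = A ∧ ∀ a : Fin L → ℂ, 0 ≤ (star a ⬝ᵥ (A *ᵥ a)).re :=
  ⟨hA.isHermitian, fun a => hA.re_dotProduct_nonneg a⟩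

/-- V = I - gg*/(1/S + ‖g‖²) - E*(EE*)⁻¹E is Hermitian positive semidefinite,
where g = (I - E*(EE*)⁻¹E)h. -/
theorem stmt11 {k L : ℕ} {S : ℝ} (hS : 0 < S) (h : Fin L → ℂ)
    (E : Matrix (Fin k) (Fin L) ℂ) [Invertible (E * Eᴴ)]
    (g : Fin L → ℂ) (hg : g = (1 - Eᴴ * (E * Eᴴ)⁻¹ * E) *ᵥ h)
    (V : Matrix (Fin L) (Fin L) ℂ)
    (hV : V = 1 - (((1 / S + nsq g : ℝ)) : ℂ)⁻¹ • vecMulVec g (star g)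
        - Eᴴ * (E * Eᴴ)⁻¹ * E) :
    Vᴴ = V ∧ ∀ a : Fin L → ℂ, 0 ≤ (star a ⬝ᵥ (V *ᵥ a)).re := by
  set P := Eᴴ * (E * Eᴴ)⁻¹ * E with hP
  have hPH : Pᴴ = P := by
    simp [hP, conjTranspose_mul, conjTranspose_nonsing_inv, Matrix.mul_assoc]
  have hPP : P * P = P := by
    calc P * P = Eᴴ * ((E * Eᴴ)⁻¹ * (E * Eᴴ)) * (E * Eᴴ)⁻¹ * E := by
          simp only [hP, Matrix.mul_assoc]
      _ = P := by rw [inv_mul_of_invertible, Matrix.mul_one]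
  have hQH : (1 - P)ᴴ = 1 - P := by simp [hPH]
  have hQQ : (1 - P) * (1 - P) = 1 - P := by
    rw [Matrix.mul_sub, Matrix.sub_mul 1 P P, hPP]; simp
  have hQg : (1 - P) *ᵥ g = g := by rw [hg, mulVec_mulVec, hQQ]
  have hd : 0 < 1 / S + nsq g := add_pos_of_pos_of_nonneg (by positivity) (nsq_nonneg g)
  have hpos := posSemidef_sub_smul_vecMulVec hQH hQQ hQg (inv_nonneg.2 hd.le) (by
    rw [inv_mul_le_one₀ hd]
    exact le_add_of_nonneg_left (by positivity))
  rw [Complex.ofReal_inv, sub_right_comm, ← hV] at hpos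
  exact hpos.conjTranspose_eq_and_re_nonneg
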